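/- Let t > 0, let ρ ∈ (0, 1], and let Q ⊆ P be a subset whose points are pairwise at distance greater than t. Then for every point q ∈ P, the number of points p ∈ Q with ‖p − q‖ ≤ t/ρ is at most λ_{t/ρ}^{⌈log₂(2/ρ)⌉}, where λ_{t/ρ} is the (t/ρ)-restricted doubling constant of P. -/

import Mathlib

open Metric

/-- `P ∩ B(p, r)` can be covered by at most `m` closed balls of radius `r/2`,
each centered at a point of `P`. -/
def CoverCond {d : ℕ} (P : Finset (EuclideanSpace ℝ (Fin d))) (m : ℕ)
    (p : EuclideanSpace ℝ (Fin d)) (r : ℝ) : Prop :=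
  ∃ C : Finset (EuclideanSpace ℝ (Fin d)), C ⊆ P ∧ C.card ≤ m ∧
    ∀ q ∈ P, dist q p ≤ r → ∃ c ∈ C, dist q c ≤ r / 2

/-- The `t`-restricted doubling constant `λ_t` of `P`: the smallest positive integer `m`
such that for all `p ∈ P` and all radii `0 < r ≤ t`, `P ∩ B(p,r)` is covered by `m`
closed balls of radius `r/2` centered at points of `P`. -/
noncomputable def restDoublingConst {d : ℕ} (P : Finset (EuclideanSpace ℝ (Fin d)))
    (t : ℝ) : ℕ :=
  sInf {m : ℕ | 0 < m ∧ ∀ p ∈ P, ∀ r : ℝ, 0 < r → r ≤ t → CoverCond P m p r}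

theorem restDoublingConst_spec {d : ℕ} (P : Finset (EuclideanSpace ℝ (Fin d))) (hP : P.Nonempty)
    (t : ℝ) {p : EuclideanSpace ℝ (Fin d)} (hp : p ∈ P) {r : ℝ} (hr0 : 0 < r) (hrt : r ≤ t) :
    CoverCond P (restDoublingConst P t) p r := by
  have hne : {m : ℕ | 0 < m ∧ ∀ p ∈ P, ∀ r : ℝ, 0 < r → r ≤ t → CoverCond P m p r}.Nonempty :=
    ⟨P.card, hP.card_pos, fun p _ r hr _ =>
      ⟨P, subset_rfl, le_rfl, fun x hx _ => ⟨x, hx, by rw [dist_self]; positivity⟩⟩⟩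
  exact (Nat.sInf_mem hne).2 p hp r hr0 hrt

/-- Iterating the doubling property `k` times covers a ball of radius `r` by `m ^ k` balls of
radius `r / 2 ^ k`. -/
theorem exists_cover_div_two_pow {d : ℕ} {P : Finset (EuclideanSpace ℝ (Fin d))} {m : ℕ} {t : ℝ}
    (h : ∀ p ∈ P, ∀ r : ℝ, 0 < r → r ≤ t → CoverCond P m p r)
    {p : EuclideanSpace ℝ (Fin d)} (hp : p ∈ P) {r : ℝ} (hr0 : 0 < r) (hrt : r ≤ t) (k : ℕ) :
    ∃ C : Finset (EuclideanSpace ℝ (Fin d)), C ⊆ P ∧ C.card ≤ m ^ k ∧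
      ∀ x ∈ P, dist x p ≤ r → ∃ c ∈ C, dist x c ≤ r / 2 ^ k := by
  classical
  induction k with
  | zero => exact ⟨{p}, by simpa using hp, by simp, fun x _ hx => ⟨p, by simp, by simpa using hx⟩⟩
  | succ k ih =>
    obtain ⟨C, hCP, hCcard, hC⟩ := ih
    have hrk : r / 2 ^ k ≤ t := (div_le_self hr0.le (one_le_pow₀ one_le_two)).trans hrt
    choose! D hDP hDcard hD using fun c (hc : c ∈ C) =>
      h c (hCP hc) (r / 2 ^ k) (by positivity) hrk
    refine ⟨C.biUnion D, Finset.biUnion_subset.2 hDP, ?_, fun x hx hxp => ?_⟩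
    · rw [pow_succ]
      exact (Finset.card_biUnion_le_card_mul C D m hDcard).trans (Nat.mul_le_mul_right m hCcard)
    · obtain ⟨c, hc, hxc⟩ := hC x hx hxp
      obtain ⟨e, he, hxe⟩ := hD c hc x hx hxc
      exact ⟨e, Finset.mem_biUnion.2 ⟨c, hc, he⟩, by rwa [pow_succ, ← div_div]⟩

theorem le_two_pow_toNat_ceil_logb {x : ℝ} (hx : 0 < x) : x ≤ 2 ^ ⌈Real.logb 2 x⌉.toNat := by
  rw [← Real.rpow_natCast, ← Real.logb_le_iff_le_rpow one_lt_two hx]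
  exact (Int.le_ceil _).trans (mod_cast Int.self_le_toNat _)

/-- If the points of `Q ⊆ P` are pairwise at distance `> t`, then any point `q ∈ P` has
at most `λ_{t/ρ}^{⌈log₂ (2/ρ)⌉}` points of `Q` within distance `t/ρ`, for `ρ ∈ (0, 1]`. -/
theorem separated_neighbours_bound {d : ℕ} (P Q : Finset (EuclideanSpace ℝ (Fin d)))
    (hP : P.Nonempty) (t ρ : ℝ) (ht : 0 < t) (hρ0 : 0 < ρ) (hρ1 : ρ ≤ 1)
    (hQP : Q ⊆ P)
    (hsep : ∀ q₁ ∈ Q, ∀ q₂ ∈ Q, q₁ ≠ q₂ → t < dist q₁ q₂)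
    (q : EuclideanSpace ℝ (Fin d)) (hq : q ∈ P) :
    (Q.filter (fun p => dist p q ≤ t / ρ)).card ≤
      restDoublingConst P (t / ρ) ^ (⌈Real.logb 2 (2 / ρ)⌉.toNat) := by
  obtain ⟨C, -, hCcard, hC⟩ := exists_cover_div_two_pow
    (fun p hp r => restDoublingConst_spec P hP (t / ρ) hp (r := r)) hq (div_pos ht hρ0) le_rfl
    ⌈Real.logb 2 (2 / ρ)⌉.toNat
  have hrad : t / ρ / 2 ^ ⌈Real.logb 2 (2 / ρ)⌉.toNat ≤ t / 2 := by
    have hk := le_two_pow_toNat_ceil_logb (div_pos two_pos hρ0)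
    calc t / ρ / 2 ^ ⌈Real.logb 2 (2 / ρ)⌉.toNat ≤ t / ρ / (2 / ρ) := by gcongr
      _ = t / 2 := by field_simp
  choose! f hfC hf using hC
  refine (Finset.card_le_card_of_injOn f (fun x hx => ?_) fun x hx y hy hxy => ?_).trans hCcard
  · obtain ⟨hxQ, hxq⟩ := Finset.mem_filter.1 hx
    exact hfC x (hQP hxQ) hxq
  · obtain ⟨hxQ, hxq⟩ := Finset.mem_filter.1 hx
    obtain ⟨hyQ, hyq⟩ := Finset.mem_filter.1 hy
    by_contra hne
    have hx' := hf x (hQP hxQ) hxq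
    have hy' := hf y (hQP hyQ) hyq
    rw [← hxy] at hy'
    linarith [hsep x hxQ y hyQ hne, dist_triangle_right x y (f x)]
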